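/- Let T = ℤ^17 with Gram matrix G of U⊕U⊕E_8⊕A_1^5, with e,f the basis of the first U block and r_1,…,r_5 the A_1 basis vectors. Let Γ* = {P ∈ O(T) : the induced automorphism of T*/T fixes the class of r_1/2}. Then Γ* has exactly four orbits on Δ = {r ∈ ℤ^17 : rᵀGr = -2}, with orbit representatives e - f, 2(e+f)+r_1+r_2+r_3+r_4+r_5, r_2, and r_1: every r ∈ Δ is Γ*-equivalent to exactly one of these four vectors. -/

import Mathlib

open Matrix

/-- Gram matrix of the hyperbolic plane `U`. -/
def gramU : Matrix (Fin 2) (Fin 2) ℤ := !![0, 1; 1, 0]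

/-- Gram matrix of the negative definite root lattice whose Dynkin diagram is a chain
on nodes `0, …, n-2` together with an extra node `n-1` attached to node `k`;
for `E₈` the chain has 7 nodes and the extra node is attached to node `2`. -/
def gramRoot (n k : ℕ) : Matrix (Fin n) (Fin n) ℤ :=
  Matrix.of fun i j =>
    if i = j then -2
    else if (((i : ℕ) + 1 = j ∨ (j : ℕ) + 1 = i) ∧ (i : ℕ) + 1 ≠ n ∧ (j : ℕ) + 1 ≠ n) ∨
        ((i : ℕ) + 1 = n ∧ (j : ℕ) = k) ∨ ((j : ℕ) + 1 = n ∧ (i : ℕ) = k) then 1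
    else 0

/-- Gram matrix of the standard negative definite root lattice `E₈`. -/
def gramE8 : Matrix (Fin 8) (Fin 8) ℤ := gramRoot 8 2

/-- Orthogonal (block diagonal) sum of two Gram matrices. -/
def blockSum {m n : ℕ} (A : Matrix (Fin m) (Fin m) ℤ) (B : Matrix (Fin n) (Fin n) ℤ) :
    Matrix (Fin (m + n)) (Fin (m + n)) ℤ :=
  Matrix.of fun i j =>
    if hi : (i : ℕ) < m then
      if hj : (j : ℕ) < m then A ⟨i, hi⟩ ⟨j, hj⟩ else 0
    else
      if hj : (j : ℕ) < m then 0
      else B ⟨(i : ℕ) - m, by have := i.isLt; omega⟩ ⟨(j : ℕ) - m, by have := j.isLt; omega⟩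

/-- Gram matrix of `T = U ⊕ U ⊕ E₈ ⊕ A₁⁵` (coordinates: `e, f` at indices 0,1;
the second copy of `U` at indices 2,3; `E₈` at indices 4–11; `r₁, …, r₅` at indices 12–16). -/
def gramT : Matrix (Fin 17) (Fin 17) ℤ :=
  blockSum gramU (blockSum gramU (blockSum gramE8 (Matrix.diagonal fun _ : Fin 5 => (-2 : ℤ))))

/-- `P` is an isometry of the lattice `(ℤⁿ, G)`, i.e. `P ∈ GL(n, ℤ)` with `Pᵀ G P = G`. -/
def IsIsometry {n : ℕ} (G P : Matrix (Fin n) (Fin n) ℤ) : Prop :=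
  IsUnit P.det ∧ Pᵀ * G * P = G

/-- The basis vector `e` of the first copy of `U` in `T`. -/
def eU : Fin 17 → ℤ := Pi.single 0 1

/-- The basis vector `f` of the first copy of `U` in `T`. -/
def fU : Fin 17 → ℤ := Pi.single 1 1

/-- The basis vectors `r₁, …, r₅` of the five copies of `A₁` in `T`. -/
def rA (k : Fin 5) : Fin 17 → ℤ := Pi.single ⟨12 + (k : ℕ), by have := k.isLt; omega⟩ 1

/-- `r` and `r'` lie in the same `O(T)`-orbit. -/
def OrbEquiv (v r : Fin 17 → ℤ) : Prop :=
  ∃ P : Matrix (Fin 17) (Fin 17) ℤ, IsIsometry gramT P ∧ P.mulVec v = r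

/-- `P` belongs to `Γ* ⊆ O(T)`: it is an isometry of `T` whose induced automorphism of
the discriminant group `T*/T` fixes the class of `r₁/2`, i.e. `P r₁ ≡ r₁ mod 2ℤ¹⁷`. -/
def MemGammaStar (P : Matrix (Fin 17) (Fin 17) ℤ) : Prop :=
  IsIsometry gramT P ∧ ∀ i, (2 : ℤ) ∣ (P.mulVec (rA 0) - rA 0) i

/-- The four `Γ*`-orbit representatives `e - f`, `2(e+f)+r₁+⋯+r₅`, `r₂`, `r₁`. -/
def reps : Fin 4 → (Fin 17 → ℤ) :=
  ![eU - fU, 2 • (eU + fU) + ∑ k : Fin 5, rA k, rA 1, rA 0]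


namespace GammaStarProof

/-- Inverse of the Gram matrix of `E₈`. -/
def invE8 : Matrix (Fin 8) (Fin 8) ℤ :=
  !![-4, -7, -10, -8, -6, -4, -2, -5;
    -7, -14, -20, -16, -12, -8, -4, -10;
    -10, -20, -30, -24, -18, -12, -6, -15;
    -8, -16, -24, -20, -15, -10, -5, -12;
    -6, -12, -18, -15, -12, -8, -4, -9;
    -4, -8, -12, -10, -8, -6, -3, -6;
    -2, -4, -6, -5, -4, -3, -2, -3;
    -5, -10, -15, -12, -9, -6, -3, -8]

/-- An integral matrix that inverts the Gram matrix of `T` up to a factor 2 on `A₁⁵`. -/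
def dualT : Matrix (Fin 17) (Fin 17) ℤ :=
  blockSum gramU (blockSum gramU (blockSum invE8 (Matrix.diagonal fun _ : Fin 5 => (-1 : ℤ))))

/-- The elementary divisors of `T`. -/
def divT (i : Fin 17) : ℤ := if (i : ℕ) < 12 then 1 else 2

lemma dualT_mul : dualT * gramT = Matrix.diagonal divT := by
  have h : ∀ p : Fin 17 × Fin 17, (dualT * gramT) p.1 p.2 = Matrix.diagonal divT p.1 p.2 := by decide +kernel
  ext i j
  exact h (i, j)

lemma gramT_symm (i j : Fin 17) : gramT i j = gramT j i := by
  have h : ∀ p : Fin 17 × Fin 17, gramT p.1 p.2 = gramT p.2 p.1 := by decide +kernel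
  exact h (i, j)

/-- Upper triangular half of the Gram matrix. -/
def halfT : Matrix (Fin 17) (Fin 17) ℤ :=
  Matrix.of fun i j => if i < j then gramT i j else if i = j then gramT i j / 2 else 0

lemma gramT_half : gramT = halfT + halfTᵀ := by
  have h : ∀ p : Fin 17 × Fin 17, gramT p.1 p.2 = (halfT + halfTᵀ) p.1 p.2 := by decide +kernel
  ext i j
  exact h (i, j)

lemma det_ne : gramT.det ≠ 0 := by
  intro h
  have h1 := congrArg Matrix.det dualT_mul
  rw [Matrix.det_mul, h, Matrix.det_diagonal, mul_zero] at h1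
  have h2 : (∏ i, divT i) ≠ 0 := by decide +kernel
  exact h2 h1.symm

/-- The bilinear form of `T`. -/
noncomputable def B : LinearMap.BilinForm ℤ (Fin 17 → ℤ) := Matrix.toBilin' gramT

lemma B_apply (x y : Fin 17 → ℤ) : B x y = x ⬝ᵥ gramT.mulVec y := by
  simp [B, Matrix.toBilin'_apply']

lemma B_symm (x y : Fin 17 → ℤ) : B x y = B y x := by
  have h : gramTᵀ = gramT := by ext i j; exact gramT_symm j i
  rw [B_apply, B_apply, Matrix.dotProduct_mulVec, ← Matrix.mulVec_transpose, h, dotProduct_comm]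

lemma B_even (x : Fin 17 → ℤ) : ∃ q, B x x = 2 * q := by
  refine ⟨x ⬝ᵥ halfT.mulVec x, ?_⟩
  rw [B_apply]
  conv_lhs => rw [gramT_half]
  rw [Matrix.add_mulVec, dotProduct_add, Matrix.mulVec_transpose, dotProduct_comm x (x ᵥ* halfT),
    ← Matrix.dotProduct_mulVec]
  ring

lemma B_single (i : Fin 17) (y : Fin 17 → ℤ) : B (Pi.single i 1) y = gramT.mulVec y i := by
  rw [B_apply, single_dotProduct, one_mul]

/-- Two vectors in the same `Γ*`-orbit. -/
def Rel (v w : Fin 17 → ℤ) : Prop :=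
  ∃ P : Matrix (Fin 17) (Fin 17) ℤ, MemGammaStar P ∧ P.mulVec v = w

lemma isometry_iff (P : Matrix (Fin 17) (Fin 17) ℤ) :
    IsIsometry gramT P ↔ ∀ x y, B (P.mulVec x) (P.mulVec y) = B x y := by
  have key : ∀ x y, B (P.mulVec x) (P.mulVec y) = x ⬝ᵥ (Pᵀ * gramT * P).mulVec y := by
    intro x y
    rw [B_apply, ← Matrix.mulVec_mulVec, ← Matrix.mulVec_mulVec, Matrix.dotProduct_mulVec x,
      Matrix.vecMul_transpose]
  constructor
  · rintro ⟨_, h⟩ x y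
    rw [key, h, B_apply]
  · intro h
    have h2 : Pᵀ * gramT * P = gramT := by
      ext i j
      have := h (Pi.single i 1) (Pi.single j 1)
      rw [key, B_apply, single_dotProduct, single_dotProduct] at this
      simpa using this
    refine ⟨?_, h2⟩
    have h3 := congrArg Matrix.det h2
    rw [Matrix.det_mul, Matrix.det_mul, Matrix.det_transpose] at h3
    have h4 : P.det * P.det = 1 := by
      apply mul_right_cancel₀ det_ne
      linarith
    exact IsUnit.of_mul_eq_one _ h4

lemma Rel.refl (v : Fin 17 → ℤ) : Rel v v := by
  refine ⟨1, ⟨?_, ?_⟩, by simp⟩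
  · rw [isometry_iff]; simp
  · simp

lemma mulVec_even (P : Matrix (Fin 17) (Fin 17) ℤ) (x : Fin 17 → ℤ) (h : ∀ i, (2 : ℤ) ∣ x i) (i) :
    (2 : ℤ) ∣ P.mulVec x i := by
  change (2 : ℤ) ∣ ∑ j, P i j * x j
  exact Finset.dvd_sum fun j _ => Dvd.dvd.mul_left (h j) _

lemma Rel.trans {u v w : Fin 17 → ℤ} (h1 : Rel u v) (h2 : Rel v w) : Rel u w := by
  obtain ⟨P, ⟨hP, hP'⟩, rfl⟩ := h1
  obtain ⟨Q, ⟨hQ, hQ'⟩, rfl⟩ := h2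
  refine ⟨Q * P, ⟨?_, ?_⟩, by simp⟩
  · rw [isometry_iff] at *
    intro x y
    rw [← Matrix.mulVec_mulVec, ← Matrix.mulVec_mulVec, hQ, hP]
  · intro i
    have h := dvd_add (mulVec_even Q _ hP' i) (hQ' i)
    rw [Matrix.mulVec_sub] at h
    simpa using h

lemma Rel.symm {v w : Fin 17 → ℤ} (h : Rel v w) : Rel w v := by
  obtain ⟨P, ⟨hP, hP'⟩, rfl⟩ := h
  have hu := hP.1
  have e1 : ∀ x, P⁻¹.mulVec (P.mulVec x) = x := fun x => by
    rw [Matrix.mulVec_mulVec, Matrix.nonsing_inv_mul _ hu, Matrix.one_mulVec]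
  have e2 : ∀ x, P.mulVec (P⁻¹.mulVec x) = x := fun x => by
    rw [Matrix.mulVec_mulVec, Matrix.mul_nonsing_inv _ hu, Matrix.one_mulVec]
  refine ⟨P⁻¹, ⟨?_, ?_⟩, e1 v⟩
  · rw [isometry_iff] at *
    intro x y
    rw [← hP, e2, e2]
  · intro i
    have h := mulVec_even P⁻¹ _ hP' i
    rw [Matrix.mulVec_sub, e1] at h
    rw [← dvd_neg]
    simpa using h

lemma B_rA0 (x : Fin 17 → ℤ) : B x (rA 0) = -2 * x 12 := by
  have h : gramT 12 = Pi.single 12 (-2) := by decide +kernel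
  rw [B_symm, rA, B_single]
  change gramT 12 ⬝ᵥ x = _
  rw [h, single_dotProduct]

/-- Eichler transvections. -/
lemma rel_eichler (u a w : Fin 17 → ℤ) (hu : B u u = 0) (ha : B u a = 0) :
    ∃ c : ℤ, Rel w (w - B a w • u + B u w • a - (c * B u w) • u) := by
  obtain ⟨q, hq⟩ := B_even a
  refine ⟨q, ?_⟩
  have ha' : B a u = 0 := by rw [B_symm, ha]
  let φ : (Fin 17 → ℤ) →ₗ[ℤ] (Fin 17 → ℤ) :=
    LinearMap.id - (B a).smulRight u + (B u).smulRight a - q • (B u).smulRight u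
  have hφ : ∀ x, φ x = x - B a x • u + B u x • a - (q * B u x) • u := by
    intro x; simp [φ, mul_assoc]
  refine ⟨LinearMap.toMatrix' φ, ⟨?_, ?_⟩, ?_⟩
  · rw [isometry_iff]
    intro x y
    simp only [LinearMap.toMatrix'_mulVec, hφ]
    simp only [map_add, map_sub, map_smul, LinearMap.add_apply, LinearMap.sub_apply,
      LinearMap.smul_apply, smul_eq_mul, hu, ha, ha', hq, B_symm x u, B_symm x a]
    ring
  · intro i
    simp only [LinearMap.toMatrix'_mulVec, hφ, B_rA0]
    simp only [Pi.add_apply, Pi.sub_apply, Pi.smul_apply, smul_eq_mul]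
    exact ⟨a 12 * u i - u 12 * a i + q * u 12 * u i, by ring⟩
  · rw [LinearMap.toMatrix'_mulVec, hφ]

lemma rel_neg (w : Fin 17 → ℤ) : Rel w (-w) := by
  refine ⟨-1, ⟨?_, ?_⟩, by simp [Matrix.neg_mulVec]⟩
  · rw [isometry_iff]; simp [Matrix.neg_mulVec]
  · intro i
    simp only [Matrix.neg_mulVec, Matrix.one_mulVec, Pi.sub_apply, Pi.neg_apply]
    exact ⟨-rA 0 i, by ring⟩

lemma rel_perm (s : Equiv.Perm (Fin 17)) (hs : s 12 = 12)
    (hG : ∀ i j, gramT (s i) (s j) = gramT i j) (w : Fin 17 → ℤ) : Rel w (w ∘ s) := by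
  let φ : (Fin 17 → ℤ) →ₗ[ℤ] (Fin 17 → ℤ) := LinearMap.funLeft ℤ ℤ s
  have hφ : ∀ x, φ x = x ∘ s := fun x => rfl
  refine ⟨LinearMap.toMatrix' φ, ⟨?_, ?_⟩, ?_⟩
  · rw [isometry_iff]
    intro x y
    simp only [LinearMap.toMatrix'_mulVec, hφ, B_apply, dotProduct, Matrix.mulVec,
      Function.comp_apply]
    rw [← Equiv.sum_comp s (fun i => x i * ∑ j, gramT i j * y j)]
    refine Finset.sum_congr rfl fun i _ => ?_
    rw [← Equiv.sum_comp s (fun j => gramT (s i) j * y j)]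
    simp only [hG]
  · intro i
    have : rA 0 ∘ s = rA 0 := by
      ext j
      change (Pi.single (12 : Fin 17) (1 : ℤ) : Fin 17 → ℤ) (s j) =
        (Pi.single (12 : Fin 17) (1 : ℤ) : Fin 17 → ℤ) j
      have : s j = 12 ↔ j = 12 := by
        rw [← s.injective.eq_iff (a := j), hs]
      simp [Pi.single_apply, this]
    rw [LinearMap.toMatrix'_mulVec, hφ, this]
    simp
  · rw [LinearMap.toMatrix'_mulVec, hφ]

lemma Bs0 (x : Fin 17 → ℤ) : B (Pi.single 0 1) x = x 1 := by
  have h : gramT 0 = Pi.single 1 1 := by decide +kernel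
  rw [B_single]
  change gramT 0 ⬝ᵥ x = _
  rw [h, single_dotProduct, one_mul]

lemma Bs1 (x : Fin 17 → ℤ) : B (Pi.single 1 1) x = x 0 := by
  have h : gramT 1 = Pi.single 0 1 := by decide +kernel
  rw [B_single]
  change gramT 1 ⬝ᵥ x = _
  rw [h, single_dotProduct, one_mul]

lemma Bs2 (x : Fin 17 → ℤ) : B (Pi.single 2 1) x = x 3 := by
  have h : gramT 2 = Pi.single 3 1 := by decide +kernel
  rw [B_single]
  change gramT 2 ⬝ᵥ x = _
  rw [h, single_dotProduct, one_mul]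

lemma Bs3 (x : Fin 17 → ℤ) : B (Pi.single 3 1) x = x 2 := by
  have h : gramT 3 = Pi.single 2 1 := by decide +kernel
  rw [B_single]
  change gramT 3 ⬝ᵥ x = _
  rw [h, single_dotProduct, one_mul]

lemma Rel.norm {v w : Fin 17 → ℤ} (h : Rel v w) : B w w = B v v := by
  obtain ⟨P, ⟨hP, -⟩, rfl⟩ := h
  rw [isometry_iff] at hP
  exact hP v v

lemma rel_perm2 (s : Equiv.Perm (Fin 17)) (hs : s 12 = 12)
    (hG : ∀ p : Fin 17 × Fin 17, gramT (s p.1) (s p.2) = gramT p.1 p.2) (w : Fin 17 → ℤ) :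
    Rel w (w ∘ s) :=
  rel_perm s hs (fun i j => hG (i, j)) w

lemma rel_swapU (w : Fin 17 → ℤ) : ∃ w', Rel w w' ∧ w' 1 = w 2 :=
  ⟨_, rel_perm2 (Equiv.swap 1 2 * Equiv.swap 0 3) (by decide) (by decide +kernel) w, rfl⟩

lemma rel_swap01 (w : Fin 17 → ℤ) : ∃ w', Rel w w' ∧ w' 1 = w 0 :=
  ⟨_, rel_perm2 (Equiv.swap 0 1) (by decide) (by decide +kernel) w, rfl⟩

lemma rel_swap23 (w : Fin 17 → ℤ) : ∃ w', Rel w w' ∧ w' 1 = w 1 ∧ w' 2 = w 3 :=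
  ⟨_, rel_perm2 (Equiv.swap 2 3) (by decide) (by decide +kernel) w, rfl, rfl⟩

/-- Translation of the last 15 coordinates by multiples of the coefficient of `f`. -/
lemma rel_translate (w a : Fin 17 → ℤ) (ha : a 1 = 0) :
    ∃ w', Rel w w' ∧ ∀ i, i ≠ 0 → w' i = w i + w 1 * a i := by
  obtain ⟨c, hc⟩ := rel_eichler (Pi.single 0 1) a w (by rw [Bs0]; rfl) (by rw [Bs0, ha])
  refine ⟨_, hc, fun i hi => ?_⟩
  simp [Bs0, hi]

/-- Adding `B(a,w)` to the coefficient of the second copy of `U`. -/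
lemma rel_probe (w : Fin 17 → ℤ) (h3 : w 3 = 0) (i : Fin 17) (hi : 4 ≤ i) :
    ∃ w', Rel w w' ∧ w' 1 = w 1 ∧ w' 2 = w 2 - gramT.mulVec w i := by
  have h : (3 : Fin 17) ≠ i := by rintro rfl; exact absurd hi (by decide)
  obtain ⟨c, hc⟩ := rel_eichler (Pi.single 2 1) (Pi.single i 1) w (by rw [Bs2]; rfl)
    (by rw [Bs2]; simp [h])
  rw [Bs2, B_single, h3] at hc
  exact ⟨_, hc, by simp, by simp⟩

lemma rel_probe0 (w : Fin 17 → ℤ) (h3 : w 3 = 0) :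
    ∃ w', Rel w w' ∧ w' 1 = w 1 ∧ w' 2 = w 2 - w 0 := by
  obtain ⟨c, hc⟩ := rel_eichler (Pi.single 2 1) (Pi.single 1 1) w (by rw [Bs2]; rfl)
    (by rw [Bs2]; rfl)
  rw [Bs2, Bs1, h3] at hc
  exact ⟨_, hc, by simp, by simp⟩

lemma exists_ne (v : Fin 17 → ℤ) (hv : B v v = -2) : ∃ w, Rel v w ∧ w 1 ≠ 0 := by
  by_contra! H
  have h1 := H v (Rel.refl v)
  have h0 : v 0 = 0 := by
    obtain ⟨w, hw, e⟩ := rel_swap01 v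
    rw [← e, H w hw]
  have H2 : ∀ w, Rel v w → w 2 = 0 := by
    intro w hw
    obtain ⟨w', hw', e⟩ := rel_swapU w
    rw [← e, H w' (hw.trans hw')]
  have h3 : v 3 = 0 := by
    obtain ⟨w, hw, -, e⟩ := rel_swap23 v
    rw [← e, H2 w hw]
  have h2 := H2 v (Rel.refl v)
  have hG : ∀ i, 4 ≤ i → gramT.mulVec v i = 0 := by
    intro i hi
    obtain ⟨w, hw, -, e⟩ := rel_probe v h3 i hi
    have := H2 w hw
    omega
  have : gramT.mulVec v = 0 := by
    ext i
    by_cases hi : 4 ≤ i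
    · exact hG i hi
    · have : i = 0 ∨ i = 1 ∨ i = 2 ∨ i = 3 := by
        revert hi; revert i; decide
      rw [← B_single]
      rcases this with rfl | rfl | rfl | rfl
      · rw [Bs0, h1]; rfl
      · rw [Bs1, h0]; rfl
      · rw [Bs2, h3]; rfl
      · rw [Bs3, h2]; rfl
  rw [B_apply, this, dotProduct_zero] at hv
  omega

/-- The descent: some vector `w` in the orbit has `w 1 = g` with `g ∣ B(w, T)`. -/
lemma exists_min (v : Fin 17 → ℤ) (hv : B v v = -2) :
    ∃ w, Rel v w ∧ 0 < w 1 ∧ ∀ i, w 1 ∣ gramT.mulVec w i := by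
  classical
  have hne : ∃ n : ℕ, 0 < n ∧ ∃ w, Rel v w ∧ w 1 = n := by
    obtain ⟨w, hw, h1⟩ := exists_ne v hv
    refine ⟨(w 1).natAbs, by omega, ?_⟩
    rcases le_total 0 (w 1) with h | h
    · exact ⟨w, hw, by omega⟩
    · exact ⟨-w, hw.trans (rel_neg w), by simp only [Pi.neg_apply]; omega⟩
  obtain ⟨hg, w0, hw0, e0⟩ := Nat.find_spec hne
  have hmin : ∀ w, Rel v w → 0 < w 1 → (Nat.find hne : ℤ) ≤ w 1 := by
    intro w hw h
    have := Nat.find_min' hne (m := (w 1).toNat) ⟨by omega, w, hw, by omega⟩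
    omega
  generalize Nat.find hne = g at *
  have hg' : (0 : ℤ) < g := by exact_mod_cast hg
  have h2 : ∀ w, Rel v w → w 1 = g → (g : ℤ) ∣ w 2 := by
    intro w hw e
    obtain ⟨w', hw', e'⟩ := rel_translate w (Pi.single 2 (-(w 2 / g))) rfl
    obtain ⟨w'', hw'', e''⟩ := rel_swapU w'
    have e2 := e' 2 (by decide)
    have e3 : w'' 1 = w 2 % g := by
      rw [e'', e2, e, Pi.single_eq_same, Int.emod_def]; ring
    have hm := hmin w'' ((hw.trans hw').trans hw'')
    have a1 := Int.emod_nonneg (w 2) hg'.ne'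
    have a2 := Int.emod_lt_of_pos (w 2) hg'
    apply Int.dvd_of_emod_eq_zero
    by_contra h
    have := hm (by omega)
    omega
  have h3 : ∀ w, Rel v w → w 1 = g → (g : ℤ) ∣ w 3 := by
    intro w hw e
    obtain ⟨w', hw', e1, e2⟩ := rel_swap23 w
    rw [← e2]
    exact h2 w' (hw.trans hw') (e1.trans e)
  obtain ⟨k, hk⟩ := h3 w0 hw0 e0
  obtain ⟨w, hw', e⟩ := rel_translate w0 (Pi.single 3 (-k)) rfl
  have hw := hw0.trans hw'
  have w1 : w 1 = g := by
    rw [e 1 (by decide), e0]; simp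
  have w3 : w 3 = 0 := by
    rw [e 3 (by decide), e0, hk]; simp
  have w2 := h2 w hw w1
  refine ⟨w, hw, by omega, fun i => ?_⟩
  rw [w1]
  by_cases hi : 4 ≤ i
  · obtain ⟨x, hx, x1, x2⟩ := rel_probe w w3 i hi
    have := h2 x (hw.trans hx) (x1.trans w1)
    rw [x2] at this
    exact (dvd_sub_right w2).1 this
  · have : i = 0 ∨ i = 1 ∨ i = 2 ∨ i = 3 := by
      revert hi; clear * -; revert i; decide
    rw [← B_single]
    rcases this with rfl | rfl | rfl | rfl
    · rw [Bs0, w1]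
    · rw [Bs1]
      obtain ⟨x, hx, x1, x2⟩ := rel_probe0 w w3
      have := h2 x (hw.trans hx) (x1.trans w1)
      rw [x2] at this
      exact (dvd_sub_right w2).1 this
    · rw [Bs2, w3]; exact dvd_zero _
    · rw [Bs3]; exact w2

lemma even_of_div (w : Fin 17 → ℤ) (h : ∀ i, (2 : ℤ) ∣ gramT.mulVec w i) (i : Fin 17)
    (hi : (i : ℕ) < 12) : (2 : ℤ) ∣ w i := by
  have h1 := mulVec_even dualT _ h i
  rw [Matrix.mulVec_mulVec, dualT_mul, Matrix.mulVec_diagonal, divT, if_pos hi, one_mul] at h1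
  exact h1

/-- Normal forms with vanishing `E₈` and second `U` components. -/
def nf (x y a b c d k : ℤ) : Fin 17 → ℤ := ![x, y, 0, 0, 0, 0, 0, 0, 0, 0, 0, 0, a, b, c, d, k]

lemma gram_nf (x y a b c d k : ℤ) : gramT.mulVec (nf x y a b c d k) =
    nf y x (-2 * a) (-2 * b) (-2 * c) (-2 * d) (-2 * k) := by
  have h0 : nf x y a b c d k = x • nf 1 0 0 0 0 0 0 + y • nf 0 1 0 0 0 0 0
    + a • nf 0 0 1 0 0 0 0 + b • nf 0 0 0 1 0 0 0 + c • nf 0 0 0 0 1 0 0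
    + d • nf 0 0 0 0 0 1 0 + k • nf 0 0 0 0 0 0 1 := by
    simp [nf]
  have g1 : gramT.mulVec (nf 1 0 0 0 0 0 0) = nf 0 1 0 0 0 0 0 := by decide +kernel
  have g2 : gramT.mulVec (nf 0 1 0 0 0 0 0) = nf 1 0 0 0 0 0 0 := by decide +kernel
  have g3 : gramT.mulVec (nf 0 0 1 0 0 0 0) = nf 0 0 (-2) 0 0 0 0 := by decide +kernel
  have g4 : gramT.mulVec (nf 0 0 0 1 0 0 0) = nf 0 0 0 (-2) 0 0 0 := by decide +kernel
  have g5 : gramT.mulVec (nf 0 0 0 0 1 0 0) = nf 0 0 0 0 (-2) 0 0 := by decide +kernel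
  have g6 : gramT.mulVec (nf 0 0 0 0 0 1 0) = nf 0 0 0 0 0 (-2) 0 := by decide +kernel
  have g7 : gramT.mulVec (nf 0 0 0 0 0 0 1) = nf 0 0 0 0 0 0 (-2) := by decide +kernel
  rw [h0]
  simp only [Matrix.mulVec_add, Matrix.mulVec_smul, g1, g2, g3, g4, g5, g6, g7]
  simp [nf, mul_comm]

lemma B_nf (x y a b c d k : ℤ) : B (nf x y a b c d k) (nf x y a b c d k) =
    2 * x * y - 2 * (a * a + b * b + c * c + d * d + k * k) := by
  rw [B_apply, gram_nf]
  simp [nf, dotProduct, Fin.sum_univ_succ]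
  ring

lemma rep0 : reps 0 = nf 1 (-1) 0 0 0 0 0 := by decide +kernel
lemma rep1 : reps 1 = nf 2 2 1 1 1 1 1 := by decide +kernel
lemma rep2 : reps 2 = nf 0 0 0 1 0 0 0 := by decide +kernel
lemma rep3 : reps 3 = nf 0 0 1 0 0 0 0 := by decide +kernel

lemma eq_nf (w : Fin 17 → ℤ) (h : ∀ i : Fin 17, 2 ≤ i → i < 12 → w i = 0) :
    w = nf (w 0) (w 1) (w 12) (w 13) (w 14) (w 15) (w 16) := by
  have a2 := h 2 (by decide) (by decide)
  have a3 := h 3 (by decide) (by decide)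
  have a4 := h 4 (by decide) (by decide)
  have a5 := h 5 (by decide) (by decide)
  have a6 := h 6 (by decide) (by decide)
  have a7 := h 7 (by decide) (by decide)
  have a8 := h 8 (by decide) (by decide)
  have a9 := h 9 (by decide) (by decide)
  have a10 := h 10 (by decide) (by decide)
  have a11 := h 11 (by decide) (by decide)
  ext i
  fin_cases i <;> first | rfl | assumption

/-- Removing `2f` from `2f + r_i`. -/
lemma rel_drop (i : Fin 17) (z : Fin 17 → ℤ) (_ : z = Pi.single i 1)
    (hi : B z z = -2) (h0 : z 0 = 0) :
    Rel (z + (2 : ℤ) • Pi.single 1 1) z := by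
  obtain ⟨c, hc⟩ := rel_eichler (Pi.single 1 1) z z (by rw [Bs1]; rfl) (by rw [Bs1, h0])
  rw [Bs1, h0, hi] at hc
  refine Rel.symm ?_
  convert hc using 1
  simp

lemma rel_r (k : Fin 17) (hk : k ≠ 12) (hG : ∀ p : Fin 17 × Fin 17,
    gramT ((Equiv.swap 13 k) p.1) ((Equiv.swap 13 k) p.2) = gramT p.1 p.2) :
    Rel (Pi.single 13 1) (Pi.single k 1) := by
  have h := rel_perm2 (Equiv.swap 13 k) (Equiv.swap_apply_of_ne_of_ne (by decide) hk.symm) hG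
    (Pi.single 13 1)
  convert h using 1
  ext j
  have : (Equiv.swap 13 k) j = 13 ↔ j = k := by
    constructor
    · intro h
      have := congrArg (Equiv.swap 13 k) h
      simpa using this
    · rintro rfl; simp
  simp [Pi.single_apply, this]

/-- Divisibility by two in the dual lattice. -/
def Div2 (v : Fin 17 → ℤ) : Prop := ∀ i, (2 : ℤ) ∣ gramT.mulVec v i

lemma Div2.B {v : Fin 17 → ℤ} (h : Div2 v) (x : Fin 17 → ℤ) : (2 : ℤ) ∣ B x v := by
  rw [B_apply]
  exact Finset.dvd_sum fun i _ => Dvd.dvd.mul_left (h i) _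

lemma Rel.div2 {v w : Fin 17 → ℤ} (h : Rel v w) (hw : Div2 w) : Div2 v := by
  obtain ⟨P, ⟨hP, -⟩, rfl⟩ := h
  rw [isometry_iff] at hP
  intro i
  rw [← B_single, ← hP]
  exact hw.B _

lemma exists_rep (v : Fin 17 → ℤ) (hv : B v v = -2) : ∃ k, Rel (reps k) v := by
  obtain ⟨w, hw, hpos, hdiv⟩ := exists_min v hv
  have hww : B w w = -2 := by rw [hw.norm, hv]
  have hd2 : w 1 ∣ 2 := by
    have : w 1 ∣ B w w := by
      rw [B_apply]
      exact Finset.dvd_sum fun i _ => Dvd.dvd.mul_left (hdiv i) _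
    rw [hww] at this
    exact (dvd_neg).1 this
  have h12 : w 1 = 1 ∨ w 1 = 2 := by
    have := Int.le_of_dvd (by norm_num) hd2
    omega
  rcases h12 with h1 | h1
  · obtain ⟨w', hw', e⟩ := rel_translate w (fun i => if i = 1 then 0 else - w i) rfl
    have e1 : w' 1 = 1 := by rw [e 1 (by decide), h1]; simp
    have e2 : ∀ i : Fin 17, 2 ≤ i → w' i = 0 := by
      intro i hi
      have i0 : i ≠ 0 := by rintro rfl; exact absurd hi (by decide)
      have i1 : i ≠ 1 := by rintro rfl; exact absurd hi (by decide)
      rw [e i i0, h1]; simp [i1]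
    have hn := eq_nf w' (fun i hi _ => e2 i hi)
    rw [e1, e2 12 (by decide), e2 13 (by decide), e2 14 (by decide), e2 15 (by decide),
      e2 16 (by decide)] at hn
    have hN : B w' w' = -2 := by rw [hw'.norm, hww]
    rw [hn, B_nf] at hN
    have : w' 0 = -1 := by omega
    rw [this] at hn
    refine ⟨0, Rel.symm ((hw.trans hw').trans ?_)⟩
    have h := rel_neg w'
    convert h using 1
    rw [hn, rep0]; decide +kernel
  · rw [h1] at hdiv
    obtain ⟨w', hw', e⟩ := rel_translate w (fun i => if i = 1 then 0 else - (w i / 2)) rfl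
    have e1 : w' 1 = 2 := by rw [e 1 (by decide), h1]; simp
    have e2 : ∀ i : Fin 17, 2 ≤ i → w' i = w i % 2 := by
      intro i hi
      have i0 : i ≠ 0 := by rintro rfl; exact absurd hi (by decide)
      have i1 : i ≠ 1 := by rintro rfl; exact absurd hi (by decide)
      rw [e i i0, h1, if_neg i1]; omega
    have hn := eq_nf w' (fun i hi hi' => by
      rw [e2 i hi]
      exact Int.emod_eq_zero_of_dvd (even_of_div w hdiv i hi'))
    have hN : B w' w' = -2 := by rw [hw'.norm, hww]
    have f1 : w' 12 = 0 ∨ w' 12 = 1 := by rw [e2 12 (by decide)]; omega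
    have f2 : w' 13 = 0 ∨ w' 13 = 1 := by rw [e2 13 (by decide)]; omega
    have f3 : w' 14 = 0 ∨ w' 14 = 1 := by rw [e2 14 (by decide)]; omega
    have f4 : w' 15 = 0 ∨ w' 15 = 1 := by rw [e2 15 (by decide)]; omega
    have f5 : w' 16 = 0 ∨ w' 16 = 1 := by rw [e2 16 (by decide)]; omega
    rw [e1] at hn
    have hx : (2 : ℤ) ∣ w' 0 := by
      rw [← Bs1 w']
      exact (hw'.symm.div2 hdiv).B _
    generalize w' 0 = x at hn hx
    generalize w' 12 = a at hn f1
    generalize w' 13 = b at hn f2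
    generalize w' 14 = c at hn f3
    generalize w' 15 = d at hn f4
    generalize w' 16 = k at hn f5
    rw [hn, B_nf] at hN
    suffices h : ∃ k, Rel w' (reps k) by
      obtain ⟨k, hk⟩ := h
      exact ⟨k, ((hw.trans hw').trans hk).symm⟩
    clear e e1 e2 hw' hdiv h1 hd2 hpos hww hw hv
    have drop : ∀ i : Fin 17, ∀ z, z = Pi.single i 1 → B z z = -2 → z 0 = 0 →
        (z + (2 : ℤ) • Pi.single 1 1 = w') → Rel w' (Pi.single i 1) := by
      intro i z hz h1 h2 h3
      have := rel_drop i z hz h1 h2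
      rw [h3, hz] at this
      exact this
    rcases f1 with rfl | rfl <;> rcases f2 with rfl | rfl <;> rcases f3 with rfl | rfl <;>
      rcases f4 with rfl | rfl <;> rcases f5 with rfl | rfl <;> try (exfalso; omega)
    · obtain rfl : x = 0 := by omega
      refine ⟨2, (drop 16 (nf 0 0 0 0 0 0 1) (by decide +kernel) (by rw [B_nf]; rfl) rfl
        (by rw [hn]; decide +kernel)).trans ?_⟩
      have : reps 2 = Pi.single 13 1 := by decide +kernel
      rw [this]
      exact (rel_r 16 (by decide) (by decide +kernel)).symm
    · obtain rfl : x = 0 := by omega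
      refine ⟨2, (drop 15 (nf 0 0 0 0 0 1 0) (by decide +kernel) (by rw [B_nf]; rfl) rfl
        (by rw [hn]; decide +kernel)).trans ?_⟩
      have : reps 2 = Pi.single 13 1 := by decide +kernel
      rw [this]
      exact (rel_r 15 (by decide) (by decide +kernel)).symm
    · obtain rfl : x = 0 := by omega
      refine ⟨2, (drop 14 (nf 0 0 0 0 1 0 0) (by decide +kernel) (by rw [B_nf]; rfl) rfl
        (by rw [hn]; decide +kernel)).trans ?_⟩
      have : reps 2 = Pi.single 13 1 := by decide +kernel
      rw [this]
      exact (rel_r 14 (by decide) (by decide +kernel)).symm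
    · obtain rfl : x = 0 := by omega
      have := drop 13 (nf 0 0 0 1 0 0 0) (by decide +kernel) (by rw [B_nf]; rfl) rfl
        (by rw [hn]; decide +kernel)
      exact ⟨2, this⟩
    · obtain rfl : x = 0 := by omega
      have := drop 12 (nf 0 0 1 0 0 0 0) (by decide +kernel) (by rw [B_nf]; rfl) rfl
        (by rw [hn]; decide +kernel)
      exact ⟨3, this⟩
    · obtain rfl : x = 2 := by omega
      exact ⟨1, by rw [rep1, hn]; exact Rel.refl _⟩

lemma Rel.mod4 {v w : Fin 17 → ℤ} (h : Rel v w) (hw : Div2 w) : (2 : ℤ) ∣ v 12 - w 12 := by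
  obtain ⟨P, ⟨hP, hP'⟩, rfl⟩ := h
  rw [isometry_iff] at hP
  have h1 := hP v (rA 0)
  choose y hy using hP'
  have h2 : P.mulVec (rA 0) = rA 0 + (2 : ℤ) • (y : Fin 17 → ℤ) := by
    ext i
    have := hy i
    simp only [Pi.sub_apply] at this
    simp only [Pi.add_apply, Pi.smul_apply, smul_eq_mul]
    linarith
  rw [h2, map_add, map_smul, B_rA0, B_rA0, B_symm _ y, smul_eq_mul] at h1
  obtain ⟨c, hc⟩ := hw.B y
  omega

lemma Rel.r1 {w : Fin 17 → ℤ} (h : Rel (reps 3) w) (i : Fin 17) : (2 : ℤ) ∣ w i - reps 3 i := by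
  obtain ⟨P, ⟨-, hP'⟩, rfl⟩ := h
  exact hP' i

lemma d1 : Div2 (reps 1) := by unfold Div2; decide +kernel
lemma d2 : Div2 (reps 2) := by unfold Div2; decide +kernel
lemma d3 : Div2 (reps 3) := by unfold Div2; decide +kernel
lemma d0 : ¬ Div2 (reps 0) := by unfold Div2; decide +kernel

lemma n12 : ¬ Rel (reps 1) (reps 2) := fun h => absurd (h.mod4 d2) (by decide +kernel)
lemma n32 : ¬ Rel (reps 3) (reps 2) := fun h => absurd (h.mod4 d2) (by decide +kernel)
lemma n31 : ¬ Rel (reps 3) (reps 1) := fun h => absurd (h.r1 13) (by decide +kernel)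

lemma rep_unique (i j : Fin 4) (h : Rel (reps i) (reps j)) : i = j := by
  fin_cases i <;> fin_cases j
  · rfl
  · exact absurd (h.div2 d1) d0
  · exact absurd (h.div2 d2) d0
  · exact absurd (h.div2 d3) d0
  · exact absurd (h.symm.div2 d1) d0
  · rfl
  · exact absurd h n12
  · exact absurd h.symm n31
  · exact absurd (h.symm.div2 d2) d0
  · exact absurd h.symm n12
  · rfl
  · exact absurd h.symm n32
  · exact absurd (h.symm.div2 d3) d0
  · exact absurd h n31
  · exact absurd h n32
  · rfl

end GammaStarProof

/-- `Γ*` has exactly four orbits on `Δ = {r : B(r,r) = -2}`, with representatives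
`e - f`, `2(e+f)+r₁+⋯+r₅`, `r₂` and `r₁`. -/
theorem GammaStar_orbits_on_roots (r : Fin 17 → ℤ) (hr : r ⬝ᵥ gramT.mulVec r = -2) :
    ∃! k : Fin 4, ∃ P : Matrix (Fin 17) (Fin 17) ℤ, MemGammaStar P ∧ P.mulVec (reps k) = r := by
  
  obtain ⟨k, hk⟩ := GammaStarProof.exists_rep r (by rw [GammaStarProof.B_apply]; exact hr)
  refine ⟨k, hk, fun j hj => ?_⟩
  exact GammaStarProof.rep_unique j k (GammaStarProof.Rel.trans hj (GammaStarProof.Rel.symm hk))
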